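/- Let F be a field and let a, b, c, M, N, K be nonnegative integers with aK < M, bK < N, and (a+c)K < M. Assume either that F has characteristic 0, or that F has characteristic p for a prime p with M + (c−a)K ≤ p (as integers). Let I = (x^M, y^N, (x^a y^b (x+y)^c)^K) ⊆ F[x,y]. Then, with respect to the lexicographic monomial order with x > y, the ideal LT(I) generated by the leading monomials of all nonzero elements of I equals the monomial ideal (x^M, y^N, x^{(a+c)K} y^{bK}) + ( x^{(a+c)K−t−1} y^{(M−(a+c)K)+bK+2t+1} : 0 ≤ t ≤ cK−1 ). -/

import Mathlib

open MvPolynomial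

/-- `LeadPair g i j` says that `x^i y^j` is the leading monomial of `g` with respect to the
lexicographic monomial order with `x > y` on `F[x,y]`. -/
def LeadPair {F : Type*} [Field F] (g : MvPolynomial (Fin 2) F) (i j : ℕ) : Prop :=
  MvPolynomial.coeff (Finsupp.single 0 i + Finsupp.single 1 j) g ≠ 0 ∧
  ∀ i' j' : ℕ, MvPolynomial.coeff (Finsupp.single 0 i' + Finsupp.single 1 j') g ≠ 0 →
    i' < i ∨ (i' = i ∧ j' ≤ j)

/-- The set of leading monomials of nonzero elements of an ideal `I` of `F[x,y]`. -/
def ltMon {F : Type*} [Field F] (I : Ideal (MvPolynomial (Fin 2) F)) :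
    Set (MvPolynomial (Fin 2) F) :=
  {q | ∃ g ∈ I, g ≠ 0 ∧ ∃ i j : ℕ, LeadPair g i j ∧ q = X 0 ^ i * X 1 ^ j}

section Univariate

open Polynomial

variable {F : Type*} [Field F]

/-- A polynomial of small degree whose `k`-th derivative vanishes has degree less than `k`. -/
lemma degree_lt_of_iterate_derivative_eq_zero {n k : ℕ}
    (hF : ∀ r : ℕ, 0 < r → r < n → (r : F) ≠ 0) {Q : F[X]} (hQ : Q.degree < n)
    (h : derivative^[k] Q = 0) : Q.degree < k := by
  rw [Polynomial.degree_lt_iff_coeff_zero] at hQ ⊢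
  intro r hr
  rcases le_or_gt n r with hnr | hnr
  · exact hQ r hnr
  · have h1 := congrArg (fun q => Polynomial.coeff q (r - k)) h
    simp only [Polynomial.coeff_iterate_derivative, Polynomial.coeff_zero, nsmul_eq_mul,
      Nat.sub_add_cancel hr] at h1
    refine (mul_eq_zero.mp h1).resolve_left ?_
    rw [Nat.descFactorial_eq_prod_range, Nat.cast_prod, ← ne_eq, Finset.prod_ne_zero_iff]
    intro s hs
    have := Finset.mem_range.mp hs
    exact hF _ (by omega) (by omega)

lemma eq_zero_of_degree_add_lt {m c k : ℕ} (hF : ∀ r : ℕ, 0 < r → r < m + c → (r : F) ≠ 0)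
    (hkc : k ≤ c) (hcm : c ≤ m) {U V : F[X]}
    (hP : (U * Polynomial.X ^ m + V * (Polynomial.X + 1) ^ c).degree < (k : WithBot ℕ))
    (hV : (V * (Polynomial.X + 1) ^ c).degree < ((m + c - k : ℕ) : WithBot ℕ)) :
    U = 0 ∧ V = 0 := by
  have hmon : ∀ r : ℕ, ((Polynomial.X + 1 : F[X]) ^ r).degree = r := fun r => by
    rw [← map_one Polynomial.C, degree_pow, degree_X_add_C]; simp
  set Q := V * (Polynomial.X + 1) ^ c with hQ
  have hsum : derivative^[k] (U * Polynomial.X ^ m) + derivative^[k] Q = 0 := by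
    rw [← iterate_map_add]
    by_cases h0 : U * Polynomial.X ^ m + Q = 0
    · rw [h0, iterate_derivative_zero]
    · exact iterate_derivative_eq_zero ((natDegree_lt_iff_degree_lt h0).mpr hP)
  have hd1 : Polynomial.X ^ (m - k) ∣ derivative^[k] Q := by
    rw [eq_neg_of_add_eq_zero_right hsum]
    exact (pow_sub_dvd_iterate_derivative_of_pow_dvd k (dvd_mul_left _ _)).neg_right
  have hd2 : (Polynomial.X + 1) ^ (c - k) ∣ derivative^[k] Q :=
    pow_sub_dvd_iterate_derivative_of_pow_dvd k (dvd_mul_left _ _)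
  have hcop : IsCoprime (Polynomial.X ^ (m - k) : F[X]) ((Polynomial.X + 1) ^ (c - k)) :=
    IsCoprime.pow ⟨-1, 1, by ring⟩
  have hDQ : derivative^[k] Q = 0 := by
    refine eq_zero_of_dvd_of_degree_lt (hcop.mul_dvd hd1 hd2) ?_
    rw [degree_mul, hmon, degree_X_pow, ← Nat.cast_add, Polynomial.degree_lt_iff_coeff_zero]
    intro r hr
    rw [Polynomial.coeff_iterate_derivative,
      (Polynomial.degree_lt_iff_coeff_zero _ _).mp hV _ (by omega), smul_zero]
  have hQk : Q.degree < k := degree_lt_of_iterate_derivative_eq_zero hF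
    (hV.trans_le (by exact_mod_cast Nat.sub_le _ _)) hDQ
  have hQ0 : Q = 0 := by
    refine eq_zero_of_dvd_of_degree_lt (hQ ▸ dvd_mul_left ((Polynomial.X + 1) ^ c) V) ?_
    rw [hmon]
    exact hQk.trans_le (by exact_mod_cast hkc)
  have hU : U * Polynomial.X ^ m = 0 := by
    refine eq_zero_of_dvd_of_degree_lt (dvd_mul_left (Polynomial.X ^ m) U) ?_
    rw [hQ0, add_zero] at hP
    rw [degree_X_pow]
    exact hP.trans_le (by exact_mod_cast hkc.trans hcm)
  have hX1 : (Polynomial.X + 1 : F[X]) ^ c ≠ 0 := fun h => by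
    have := hmon c
    simp [h] at this
  exact ⟨(mul_eq_zero.mp hU).resolve_right (pow_ne_zero _ Polynomial.X_ne_zero),
    (mul_eq_zero.mp hQ0).resolve_right hX1⟩

lemma exists_degree_add_eq {m c t : ℕ} (hF : ∀ r : ℕ, 0 < r → r < m + c → (r : F) ≠ 0)
    (hcm : c ≤ m) (htc : t < c) : ∃ U V : F[X], U.natDegree ≤ t ∧ V.natDegree ≤ m + t - c ∧
      (U * Polynomial.X ^ m + V * (Polynomial.X + 1) ^ c).degree =
        ((c - t - 1 : ℕ) : WithBot ℕ) := by
  let L : (F[X] × F[X]) →ₗ[F] (Fin (m - c + 2 * t + 1) → F) :=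
    LinearMap.pi fun i => (Polynomial.lcoeff F (c - t + i)) ∘ₗ
      ((LinearMap.mulRight F (Polynomial.X ^ m)).coprod
        (LinearMap.mulRight F ((Polynomial.X + 1) ^ c)))
  let ι : (degreeLT F (t + 1) × degreeLT F (m + t - c + 1)) →ₗ[F] (F[X] × F[X]) :=
    (degreeLT F (t + 1)).subtype.prodMap (degreeLT F (m + t - c + 1)).subtype
  have hfin : ∀ n, Module.Finite F (degreeLT F n) := fun n =>
    Module.Finite.equiv (degreeLTEquiv F n).symm
  have hrank : ∀ n, Module.finrank F (degreeLT F n) = n := fun n => by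
    rw [(degreeLTEquiv F n).finrank_eq]; simp
  have hker : LinearMap.ker (L ∘ₗ ι) ≠ ⊥ := by
    have := hfin (t + 1)
    have := hfin (m + t - c + 1)
    apply LinearMap.ker_ne_bot_of_finrank_lt
    rw [Module.finrank_prod, hrank, hrank, Module.finrank_fin_fun]
    omega
  obtain ⟨⟨⟨U, hU⟩, ⟨V, hV⟩⟩, hmem, hne⟩ := Submodule.exists_mem_ne_zero_of_ne_bot hker
  have hL : ∀ i : Fin (m - c + 2 * t + 1),
      (U * Polynomial.X ^ m + V * (Polynomial.X + 1) ^ c).coeff (c - t + i) = 0 :=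
    fun i => congrFun (LinearMap.mem_ker.mp hmem) i
  have hUn : U.natDegree ≤ t :=
    natDegree_le_of_degree_le <| Order.le_of_lt_succ <| mem_degreeLT.mp hU
  have hVn : V.natDegree ≤ m + t - c :=
    natDegree_le_of_degree_le <| Order.le_of_lt_succ <| mem_degreeLT.mp hV
  have hmon : ((Polynomial.X + 1 : F[X]) ^ c).natDegree ≤ c := by
    rw [← map_one Polynomial.C, natDegree_pow, natDegree_X_add_C, mul_one]
  have hQn : (V * (Polynomial.X + 1) ^ c).natDegree ≤ m + t :=
    natDegree_mul_le.trans (by omega)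
  have hUXn : (U * Polynomial.X ^ m).natDegree ≤ m + t :=
    natDegree_mul_le.trans (by rw [natDegree_X_pow]; omega)
  have hlt : (U * Polynomial.X ^ m + V * (Polynomial.X + 1) ^ c).degree <
      ((c - t : ℕ) : WithBot ℕ) := by
    rw [Polynomial.degree_lt_iff_coeff_zero]
    intro r hr
    by_cases hr2 : r < m + t + 1
    · have := hL ⟨r - (c - t), by omega⟩
      rwa [Nat.add_sub_cancel' hr] at this
    · rw [Polynomial.coeff_add, coeff_eq_zero_of_natDegree_lt (by omega),
        coeff_eq_zero_of_natDegree_lt (by omega), add_zero]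
  refine ⟨U, V, hUn, hVn, ?_⟩
  have hge : ¬ (U * Polynomial.X ^ m + V * (Polynomial.X + 1) ^ c).degree <
      ((c - t - 1 : ℕ) : WithBot ℕ) := by
    intro h
    have hVd : (V * (Polynomial.X + 1) ^ c).degree <
        ((m + c - (c - t - 1) : ℕ) : WithBot ℕ) :=
      lt_of_le_of_lt degree_le_natDegree (by norm_cast; omega)
    obtain ⟨rfl, rfl⟩ := eq_zero_of_degree_add_lt hF (by omega) hcm h hVd
    exact hne rfl
  refine le_antisymm ?_ (not_lt.mp hge)
  rw [Polynomial.degree_lt_iff_coeff_zero] at hlt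
  rw [Polynomial.degree_le_iff_coeff_zero]
  intro r hr
  have hr' : c - t - 1 < r := by exact_mod_cast hr
  exact hlt r (by omega)

lemma natDegree_mul_add_mul_mem_staircase {A B C M i j : ℕ}
    (hF : ∀ r : ℕ, 0 < r → r < M - A + C → (r : F) ≠ 0) (hM : A + C < M) (hi : i < M)
    {U V : F[X]} (hV : V ≠ 0 → V.natDegree + (A + B + C) ≤ i + j)
    (hH : (U * Polynomial.X ^ M + V * (Polynomial.X ^ A * (Polynomial.X + 1) ^ C)).degree =
      (i : WithBot ℕ)) :
    (A + C ≤ i ∧ B ≤ j) ∨ ∃ t < C, A + C - t - 1 ≤ i ∧ M - (A + C) + B + 2 * t + 1 ≤ j := by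
  obtain ⟨m, rfl⟩ : ∃ m, M = A + m := ⟨M - A, by omega⟩
  have hfac : U * Polynomial.X ^ (A + m) + V * (Polynomial.X ^ A * (Polynomial.X + 1) ^ C)
      = Polynomial.X ^ A * (U * Polynomial.X ^ m + V * (Polynomial.X + 1) ^ C) := by ring
  rw [hfac] at hH
  set P := U * Polynomial.X ^ m + V * (Polynomial.X + 1) ^ C with hPdef
  have hP0 : P ≠ 0 := by
    rintro h
    simp [h] at hH
  have hPi : A + P.natDegree = i := by
    have := natDegree_eq_of_degree_eq_some hH
    rwa [natDegree_mul (pow_ne_zero _ Polynomial.X_ne_zero) hP0, natDegree_X_pow] at this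
  have hX1 : ((Polynomial.X + 1 : F[X]) ^ C).natDegree = C := by
    rw [← map_one Polynomial.C, natDegree_pow, natDegree_X_add_C, mul_one]
  have hQ : ∀ n : ℕ, i + j < n + A + B →
      (V * (Polynomial.X + 1) ^ C).degree < (n : WithBot ℕ) := by
    intro n hn
    by_cases hV0 : V = 0
    · simp [hV0]
    · have h1 := hV hV0
      have h2 : (V * (Polynomial.X + 1) ^ C).natDegree ≤ V.natDegree + C :=
        natDegree_mul_le.trans (by rw [hX1])
      exact lt_of_le_of_lt degree_le_natDegree (by norm_cast; omega)
  have hm : ∀ q : F[X], q.degree < P.degree → P ≠ U * Polynomial.X ^ m + q := by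
    intro q hq h
    have hdeg : (P - q).degree = P.degree := degree_sub_eq_left_of_degree_lt hq
    rw [sub_eq_of_eq_add h] at hdeg
    have h0 : U * Polynomial.X ^ m = 0 := by
      refine eq_zero_of_dvd_of_degree_lt (dvd_mul_left (Polynomial.X ^ m) U) ?_
      rw [hdeg, degree_X_pow, degree_eq_natDegree hP0]
      norm_cast
      omega
    rw [h0, degree_zero] at hdeg
    exact hP0 (degree_eq_bot.mp hdeg.symm)
  by_contra! hcon
  obtain ⟨hcon1, hcon2⟩ := hcon
  rcases le_or_gt (A + C) i with hAC | hAC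
  · have hj := hcon1 hAC
    refine hm _ ?_ hPdef
    rw [degree_eq_natDegree hP0]
    exact hQ _ (by omega)
  · have hj := hcon2 (A + C - 1 - i) (by omega) (by omega)
    have hzero := eq_zero_of_degree_add_lt (m := m) (c := C) (k := P.natDegree + 1)
      (U := U) (V := V) (by simpa using hF) (by omega) (by omega)
      (by rw [← hPdef, degree_eq_natDegree hP0]; norm_cast; omega) (hQ _ (by omega))
    exact hP0 (by rw [hPdef, hzero.1, hzero.2]; ring)

end Univariate

section Grading

variable {F : Type*} [Field F]

/-- The ring homomorphism `x ↦ X T`, `y ↦ T` into `F[X][T]`; the coefficient of `T ^ d` is the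
dehomogenization at `y = 1` of the component of degree `d`. -/
noncomputable def gradedDehom (F : Type*) [Field F] :
    MvPolynomial (Fin 2) F →ₐ[F] Polynomial (Polynomial F) :=
  aeval ![Polynomial.C Polynomial.X * Polynomial.X, Polynomial.X]

@[simp]
lemma gradedDehom_X_zero :
    gradedDehom F (X 0) = Polynomial.C Polynomial.X * Polynomial.X := by
  simp [gradedDehom]

@[simp]
lemma gradedDehom_X_one : gradedDehom F (X 1) = Polynomial.X := by
  simp [gradedDehom]

lemma gradedDehom_monomial (s : Fin 2 →₀ ℕ) (r : F) :
    gradedDehom F (monomial s r) =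
      Polynomial.monomial (s 0 + s 1) (Polynomial.monomial (s 0) r) := by
  rw [gradedDehom, aeval_monomial, Finsupp.prod_fintype _ _ (by simp), Fin.prod_univ_two]
  simp only [Matrix.cons_val_zero, Matrix.cons_val_one, mul_pow, ← Polynomial.C_pow]
  rw [← Polynomial.C_mul_X_pow_eq_monomial, ← Polynomial.C_mul_X_pow_eq_monomial,
    Polynomial.C_mul, pow_add, IsScalarTower.algebraMap_apply F (Polynomial F)]
  simp only [Polynomial.algebraMap_eq]
  ring

lemma coeff_coeff_gradedDehom (g : MvPolynomial (Fin 2) F) (i j : ℕ) :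
    ((gradedDehom F g).coeff (i + j)).coeff i =
      coeff (Finsupp.single 0 i + Finsupp.single 1 j) g := by
  induction g using MvPolynomial.induction_on' with
  | monomial s r =>
    rw [gradedDehom_monomial, coeff_monomial, Polynomial.coeff_monomial]
    by_cases h : s = Finsupp.single 0 i + Finsupp.single 1 j
    · simp [h]
    · rw [if_neg h]
      split_ifs with h1
      · rw [Polynomial.coeff_monomial, if_neg]
        intro h2
        apply h
        ext k
        fin_cases k
        · simp [h2]
        · simp; omega
      · simp
  | add p q hp hq => simp [hp, hq]

lemma natDegree_coeff_gradedDehom_le (g : MvPolynomial (Fin 2) F) (d : ℕ) :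
    ((gradedDehom F g).coeff d).natDegree ≤ d := by
  induction g using MvPolynomial.induction_on' with
  | monomial s r =>
    rw [gradedDehom_monomial, Polynomial.coeff_monomial]
    split_ifs with h
    · exact (Polynomial.natDegree_monomial_le _).trans (by omega)
    · simp
  | add p q hp hq =>
    rw [map_add, Polynomial.coeff_add]
    exact Polynomial.natDegree_add_le_of_degree_le hp hq

lemma LeadPair.degree_coeff_gradedDehom {g : MvPolynomial (Fin 2) F} {i j : ℕ}
    (h : LeadPair g i j) : ((gradedDehom F g).coeff (i + j)).degree = i := by
  apply le_antisymm
  · rw [Polynomial.degree_le_iff_coeff_zero]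
    intro r hr
    have hr' : i < r := by exact_mod_cast hr
    rcases le_or_gt r (i + j) with hrd | hrd
    · by_contra hne
      have hco := coeff_coeff_gradedDehom g r (i + j - r)
      rw [Nat.add_sub_cancel' hrd] at hco
      have := h.2 r (i + j - r) (hco ▸ hne)
      omega
    · exact Polynomial.coeff_eq_zero_of_natDegree_lt
        ((natDegree_coeff_gradedDehom_le g _).trans_lt hrd)
  · apply Polynomial.le_degree_of_ne_zero
    rw [coeff_coeff_gradedDehom]
    exact h.1

lemma leadPair_of_gradedDehom_eq {g : MvPolynomial (Fin 2) F} {i j : ℕ} {Q : Polynomial F}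
    (hQ : Q.degree = i) (hg : gradedDehom F g = Polynomial.monomial (i + j) Q) :
    LeadPair g i j := by
  constructor
  · rw [← coeff_coeff_gradedDehom, hg, Polynomial.coeff_monomial, if_pos rfl]
    exact Polynomial.coeff_ne_zero_of_eq_degree hQ
  · intro i' j' h
    rw [← coeff_coeff_gradedDehom, hg, Polynomial.coeff_monomial] at h
    split_ifs at h with hd
    · have : i' ≤ i := by
        have := Polynomial.le_degree_of_ne_zero h
        rw [hQ] at this
        exact_mod_cast this
      omega
    · simp at h

lemma LeadPair.ne_zero {g : MvPolynomial (Fin 2) F} {i j : ℕ} (h : LeadPair g i j) : g ≠ 0 := by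
  rintro rfl
  exact h.1 (coeff_zero _)

lemma exists_gradedDehom_eq_monomial {d : ℕ} {Q : Polynomial F} (hQ : Q.natDegree ≤ d) :
    ∃ g : MvPolynomial (Fin 2) F, gradedDehom F g = Polynomial.monomial d Q := by
  refine ⟨∑ i ∈ Finset.range (d + 1),
    monomial (Finsupp.single 0 i + Finsupp.single 1 (d - i)) (Q.coeff i), ?_⟩
  conv_rhs => rw [Q.as_sum_range' (d + 1) (by omega), map_sum]
  rw [map_sum]
  refine Finset.sum_congr rfl fun i hi => ?_
  have := Finset.mem_range.mp hi
  rw [gradedDehom_monomial]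
  simp [Nat.add_sub_cancel' (Nat.lt_succ_iff.mp this)]

lemma monomial_mem_ltMon {I : Ideal (MvPolynomial (Fin 2) F)} {g : MvPolynomial (Fin 2) F}
    (hgI : g ∈ I) {i j : ℕ} {Q : Polynomial F} (hQ : Q.degree = i)
    (hg : gradedDehom F g = Polynomial.monomial (i + j) Q) : X 0 ^ i * X 1 ^ j ∈ ltMon I :=
  have h := leadPair_of_gradedDehom_eq hQ hg
  ⟨g, hgI, h.ne_zero, i, j, h, rfl⟩

lemma gradedDehom_generator (A B C : ℕ) :
    gradedDehom F (X 0 ^ A * X 1 ^ B * (X 0 + X 1) ^ C) =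
      Polynomial.monomial (A + B + C) (Polynomial.X ^ A * (Polynomial.X + 1) ^ C) := by
  rw [← Polynomial.C_mul_X_pow_eq_monomial]
  simp only [map_mul, map_pow, map_add, gradedDehom_X_zero, gradedDehom_X_one, map_one]
  have : (Polynomial.C Polynomial.X * Polynomial.X + Polynomial.X : Polynomial (Polynomial F))
      = (Polynomial.C Polynomial.X + 1) * Polynomial.X := by ring
  rw [this, mul_pow (_ + _)]
  ring

lemma degree_X_pow_mul_X_add_one_pow (A C : ℕ) :
    (Polynomial.X ^ A * (Polynomial.X + 1) ^ C : Polynomial F).degree = (A + C : ℕ) := by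
  rw [← map_one Polynomial.C, Polynomial.degree_mul, Polynomial.degree_pow, Polynomial.degree_pow,
    Polynomial.degree_X_add_C, Polynomial.degree_X]
  simp

variable {A B C M N : ℕ}

/-- Every leading monomial of the ideal is divisible by one of the claimed generators. -/
lemma LeadPair.mem_staircase (hF : ∀ r : ℕ, 0 < r → r < M - A + C → (r : F) ≠ 0)
    (hM : A + C < M) {g : MvPolynomial (Fin 2) F}
    (hg : g ∈ Ideal.span ({X 0 ^ M, X 1 ^ N, X 0 ^ A * X 1 ^ B * (X 0 + X 1) ^ C} :
      Set (MvPolynomial (Fin 2) F))) {i j : ℕ} (h : LeadPair g i j) :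
    M ≤ i ∨ N ≤ j ∨ (A + C ≤ i ∧ B ≤ j) ∨
      ∃ t < C, A + C - t - 1 ≤ i ∧ M - (A + C) + B + 2 * t + 1 ≤ j := by
  by_contra! hcon
  obtain ⟨hi, hj, hcon⟩ := hcon
  obtain ⟨u, w, v, rfl⟩ := Submodule.mem_span_triple.mp hg
  simp only [smul_eq_mul] at h
  have hdeg := h.degree_coeff_gradedDehom
  have hXM : gradedDehom F (X 0 ^ M) = Polynomial.C (Polynomial.X ^ M) * Polynomial.X ^ M := by
    simp [mul_pow]
  have hXN : gradedDehom F (X 1 ^ N) = Polynomial.X ^ N := by simp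
  have hco : ∀ (q : MvPolynomial (Fin 2) F) (n : ℕ) (Q : Polynomial F),
      (gradedDehom F q * (Polynomial.C Q * Polynomial.X ^ n)).coeff (i + j) =
      (if n ≤ i + j then (gradedDehom F q).coeff (i + j - n) else 0) * Q := by
    intro q n Q
    rw [← mul_assoc, Polynomial.coeff_mul_X_pow']
    split_ifs <;> simp
  rw [map_add, map_add, map_mul, map_mul, map_mul, gradedDehom_generator, hXM, hXN,
    ← Polynomial.C_mul_X_pow_eq_monomial, Polynomial.coeff_add, Polynomial.coeff_add, hco, hco,
    Polynomial.coeff_mul_X_pow', add_right_comm] at hdeg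
  set W := if N ≤ i + j then (gradedDehom F w).coeff (i + j - N) else 0 with hWdef
  have hW : W.degree < i := by
    rw [hWdef]
    split_ifs with hN
    · refine lt_of_le_of_lt Polynomial.degree_le_natDegree ?_
      have := natDegree_coeff_gradedDehom_le w (i + j - N)
      norm_cast
      omega
    · simp
  have hdeg' := Polynomial.degree_sub_eq_left_of_degree_lt (hdeg.symm ▸ hW)
  rw [add_sub_cancel_right, hdeg] at hdeg'
  have := natDegree_mul_add_mul_mem_staircase (B := B) (j := j) hF hM hi ?_ hdeg'
  · rcases this with ⟨h1, h2⟩ | ⟨t, ht, h1, h2⟩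
    · exact absurd h2 (not_le.mpr (hcon.1 h1))
    · exact absurd h2 (not_le.mpr (hcon.2 t ht h1))
  · intro hne
    split_ifs at hne ⊢ with hd
    · have := natDegree_coeff_gradedDehom_le v (i + j - (A + B + C))
      omega
    · exact absurd rfl hne

/-- The claimed extra generators are leading monomials of elements of the ideal. -/
lemma staircase_mem_ltMon (hF : ∀ r : ℕ, 0 < r → r < M - A + C → (r : F) ≠ 0)
    (hM : A + C < M) {t : ℕ} (ht : t < C) :
    X 0 ^ (A + C - t - 1) * X 1 ^ (M - (A + C) + B + 2 * t + 1) ∈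
      ltMon (Ideal.span ({X 0 ^ M, X 1 ^ N, X 0 ^ A * X 1 ^ B * (X 0 + X 1) ^ C} :
        Set (MvPolynomial (Fin 2) F))) := by
  obtain ⟨U, V, hU, hV, hP⟩ := exists_degree_add_eq hF (by omega) ht
  obtain ⟨u, hu⟩ := exists_gradedDehom_eq_monomial hU
  obtain ⟨v, hv⟩ := exists_gradedDehom_eq_monomial hV
  refine monomial_mem_ltMon (g := u * X 1 ^ B * X 0 ^ M +
      v * (X 0 ^ A * X 1 ^ B * (X 0 + X 1) ^ C))
    (Q := Polynomial.X ^ A * (U * Polynomial.X ^ (M - A) + V * (Polynomial.X + 1) ^ C)) ?_ ?_ ?_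
  · exact Ideal.add_mem _ (Ideal.mul_mem_left _ _ (Ideal.subset_span (by simp)))
      (Ideal.mul_mem_left _ _ (Ideal.subset_span (by simp)))
  · rw [Polynomial.degree_mul, hP, Polynomial.degree_X_pow]
    norm_cast
    omega
  · rw [map_add, map_mul _ v, gradedDehom_generator, map_mul, map_mul, hu, hv]
    have hCX : (Polynomial.C Polynomial.X : Polynomial (Polynomial F)) ^ M =
        Polynomial.C Polynomial.X ^ A * Polynomial.C Polynomial.X ^ (M - A) := by
      rw [← pow_add, Nat.add_sub_cancel' (by omega)]
    have hD : A + C - t - 1 + (M - (A + C) + B + 2 * t + 1) = t + B + M := by omega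
    have hD' : M - A + t - C + (A + B + C) = t + B + M := by omega
    rw [Polynomial.monomial_mul_monomial, hD, hD', mul_add, map_add]
    congr 1
    · simp only [map_pow, gradedDehom_X_zero, gradedDehom_X_one,
        ← Polynomial.C_mul_X_pow_eq_monomial, map_mul]
      rw [mul_pow, pow_add _ (t + B), pow_add _ t, hCX]
      ring
    · congr 1
      ring

theorem span_ltMon_eq (hF : ∀ r : ℕ, 0 < r → r < M - A + C → (r : F) ≠ 0) (hM : A + C < M) :
    Ideal.span (ltMon (Ideal.span
        ({X 0 ^ M, X 1 ^ N, X 0 ^ A * X 1 ^ B * (X 0 + X 1) ^ C} :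
          Set (MvPolynomial (Fin 2) F))))
      = Ideal.span (({X 0 ^ M, X 1 ^ N, X 0 ^ (A + C) * X 1 ^ B} :
            Set (MvPolynomial (Fin 2) F)) ∪
          {q | ∃ t : ℕ, t < C ∧
            q = X 0 ^ (A + C - t - 1) * X 1 ^ (M - (A + C) + B + 2 * t + 1)}) := by
  apply le_antisymm <;> rw [Ideal.span_le]
  · rintro _ ⟨g, hg, -, i, j, h, rfl⟩
    rcases h.mem_staircase hF hM hg with hi | hj | ⟨hi, hj⟩ | ⟨t, ht, hi, hj⟩
    · exact Ideal.mem_of_dvd _ (Dvd.dvd.mul_right (pow_dvd_pow _ hi) _)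
        (Ideal.subset_span (by simp))
    · exact Ideal.mem_of_dvd _ (Dvd.dvd.mul_left (pow_dvd_pow _ hj) _)
        (Ideal.subset_span (by simp))
    · exact Ideal.mem_of_dvd _ (mul_dvd_mul (pow_dvd_pow _ hi) (pow_dvd_pow _ hj))
        (Ideal.subset_span (by simp))
    · exact Ideal.mem_of_dvd _ (mul_dvd_mul (pow_dvd_pow _ hi) (pow_dvd_pow _ hj))
        (Ideal.subset_span (Or.inr ⟨t, ht, rfl⟩))
  · rintro _ ((rfl | rfl | rfl) | ⟨t, ht, rfl⟩)
    · apply Ideal.subset_span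
      rw [← mul_one (X 0 ^ M), ← pow_zero (X 1)]
      refine monomial_mem_ltMon (g := X 0 ^ M) (Ideal.subset_span (by simp))
        (Polynomial.degree_X_pow M) ?_
      simp [mul_pow, ← Polynomial.C_mul_X_pow_eq_monomial]
    · apply Ideal.subset_span
      rw [← one_mul (X 1 ^ N), ← pow_zero (X 0)]
      refine monomial_mem_ltMon (g := X 1 ^ N) (Ideal.subset_span (by simp))
        (Q := 1) (by simp) ?_
      simp [← Polynomial.C_mul_X_pow_eq_monomial]
    · apply Ideal.subset_span
      refine monomial_mem_ltMon (g := X 0 ^ A * X 1 ^ B * (X 0 + X 1) ^ C)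
        (Ideal.subset_span (by simp)) (degree_X_pow_mul_X_add_one_pow A C) ?_
      rw [gradedDehom_generator, add_right_comm]
    · exact Ideal.subset_span (staircase_mem_ltMon hF hM ht)

end Grading

/-- The initial ideal of `I = (x^M, y^N, (x^a y^b (x+y)^c)^K)` when
`aK < M`, `bK < N`, and `(a+c)K < M`. -/
theorem stmt11 (F : Type*) [Field F] (a b c M N K : ℕ)
    (haK : a * K < M) (hbK : b * K < N) (hacK : (a + c) * K < M)
    (hchar : CharP F 0 ∨
      ∃ p : ℕ, p.Prime ∧ CharP F p ∧ (M : ℤ) + ((c : ℤ) - (a : ℤ)) * K ≤ (p : ℤ)) :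
    Ideal.span (ltMon (Ideal.span
        ({X 0 ^ M, X 1 ^ N, (X 0 ^ a * X 1 ^ b * (X 0 + X 1) ^ c) ^ K} :
          Set (MvPolynomial (Fin 2) F))))
      = Ideal.span (({X 0 ^ M, X 1 ^ N, X 0 ^ ((a + c) * K) * X 1 ^ (b * K)} :
            Set (MvPolynomial (Fin 2) F)) ∪
          {q | ∃ t : ℕ, t < c * K ∧
            q = X 0 ^ ((a + c) * K - t - 1) *
                X 1 ^ ((M - (a + c) * K) + b * K + 2 * t + 1)}) := by
  have hF : ∀ r : ℕ, 0 < r → r < M - a * K + c * K → (r : F) ≠ 0 := by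
    intro r hr hlt h0
    rcases hchar with h | ⟨p, -, h, hp⟩
    · have := (CharP.cast_eq_zero_iff F 0 r).mp h0
      rw [zero_dvd_iff] at this
      omega
    · have hle := Nat.le_of_dvd hr ((CharP.cast_eq_zero_iff F p r).mp h0)
      rw [sub_mul] at hp
      zify [haK.le] at hlt hle
      linarith
  have hgen : ((X 0 ^ a * X 1 ^ b * (X 0 + X 1) ^ c) ^ K : MvPolynomial (Fin 2) F) =
      X 0 ^ (a * K) * X 1 ^ (b * K) * (X 0 + X 1) ^ (c * K) := by
    rw [mul_pow, mul_pow, pow_mul, pow_mul, pow_mul]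
  rw [add_mul] at hacK ⊢
  rw [hgen]
  exact span_ltMon_eq hF hacK
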